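/- arXiv:2206.00973 — 2 statements merged into one kernel-verified Lean document; each statement's English description precedes it below -/
import Mathlib

section
/- Suppose B is monotone, i.e., ⟪u − v, x − y⟫ ≥ 0 for all x, y ∈ ℝⁿ and u ∈ B x, v ∈ B y, and let x* ∈ ℝⁿ satisfy −F x* ∈ B x*. Fix μ ≥ 0, γ₀ > 0, ν ∈ (0,1/2], r ≥ 0, κ, κ⁻ ∈ [0,1/3), and 0 < γ⁻ ≤ γ₀. Let S = {x ∈ dom B : ‖x − x*‖ ≤ r/√(1 − 2ν²)} and suppose there is L > 0 with ‖F x − F y‖ ≤ L‖x − y‖ for all x, y ∈ S. Let x⁻, x ∈ S, let 0 < γ ≤ γ₀, set β(γ) = (γ⁻(1−κ))/(γ(1−κ⁻)) · (1 + 2μγ⁻/(1−κ⁻))⁻¹ and α(γ) = κ⁻γβ(γ)/γ⁻, and suppose x⁺ ∈ ℝⁿ satisfies x + α(γ)(x − x⁻) − γ(F x + β(γ)(F x − F x⁻)) ∈ x⁺ + γ·B(x⁺). Then ‖x⁺ − x*‖ ≤ (2 + 4γ₀L)·r/√(1 − 2ν²). -/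
open scoped RealInnerProductSpace

/-- If `w - p` has nonnegative inner product with `p`, then `‖p‖ ≤ ‖w‖`. -/
lemma norm_le_norm_of_inner_sub_nonneg {E : Type*} [NormedAddCommGroup E]
    [InnerProductSpace ℝ E] {w p : E} (h : 0 ≤ ⟪w - p, p⟫) : ‖p‖ ≤ ‖w‖ := by
  rw [inner_sub_left, real_inner_self_eq_norm_sq] at h
  by_contra! hlt
  nlinarith [real_inner_le_norm w p, norm_nonneg w, norm_nonneg p]

/-- Lemma 6: one backtracking trial step starting from points in the ball S
lands in the enlarged ball of radius (2 + 4γ₀L)r/√(1 − 2ν²) around x*. -/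
theorem stmt_7 (n : ℕ) (hn : 1 ≤ n)
    (B : EuclideanSpace ℝ (Fin n) → Set (EuclideanSpace ℝ (Fin n)))
    (F : EuclideanSpace ℝ (Fin n) → EuclideanSpace ℝ (Fin n))
    (hmono : ∀ x y u v, u ∈ B x → v ∈ B y → (0 : ℝ) ≤ ⟪u - v, x - y⟫)
    (xs : EuclideanSpace ℝ (Fin n)) (hxs : -F xs ∈ B xs)
    (μ γ₀ ν r κ κm γm : ℝ)
    (hμ : 0 ≤ μ) (hγ₀ : 0 < γ₀) (hν0 : 0 < ν) (hν2 : ν ≤ 1 / 2) (hr : 0 ≤ r)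
    (hκ0 : 0 ≤ κ) (hκ3 : κ < 1 / 3) (hκm0 : 0 ≤ κm) (hκm3 : κm < 1 / 3)
    (hγm0 : 0 < γm) (hγmγ₀ : γm ≤ γ₀)
    (L : ℝ) (hL : 0 < L)
    (hLip : ∀ y ∈ {w | B w ≠ ∅ ∧ ‖w - xs‖ ≤ r / Real.sqrt (1 - 2 * ν ^ 2)},
            ∀ z ∈ {w | B w ≠ ∅ ∧ ‖w - xs‖ ≤ r / Real.sqrt (1 - 2 * ν ^ 2)},
      ‖F y - F z‖ ≤ L * ‖y - z‖)
    (xm x : EuclideanSpace ℝ (Fin n))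
    (hxm : xm ∈ {w | B w ≠ ∅ ∧ ‖w - xs‖ ≤ r / Real.sqrt (1 - 2 * ν ^ 2)})
    (hx : x ∈ {w | B w ≠ ∅ ∧ ‖w - xs‖ ≤ r / Real.sqrt (1 - 2 * ν ^ 2)})
    (γ β α : ℝ) (hγ0 : 0 < γ) (hγγ₀ : γ ≤ γ₀)
    (hβ : β = (γm * (1 - κ)) / (γ * (1 - κm)) * (1 + 2 * μ * γm / (1 - κm))⁻¹)
    (hα : α = κm * γ * β / γm)
    (xp : EuclideanSpace ℝ (Fin n))
    (hxp : ∃ u ∈ B xp,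
      x + α • (x - xm) - γ • (F x + β • (F x - F xm)) = xp + γ • u) :
    ‖xp - xs‖ ≤ (2 + 4 * γ₀ * L) * r / Real.sqrt (1 - 2 * ν ^ 2) := by
  obtain ⟨u, hu, hstep⟩ := hxp
  set R := r / Real.sqrt (1 - 2 * ν ^ 2) with hR
  have hR0 : 0 ≤ R := by positivity
  have hxsS : xs ∈ {w | B w ≠ ∅ ∧ ‖w - xs‖ ≤ R} :=
    ⟨Set.nonempty_iff_ne_empty.mp ⟨_, hxs⟩, by simpa using hR0⟩
  have hx_le : ‖x - xs‖ ≤ R := hx.2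
  have hdiff_le : ‖x - xm‖ ≤ 2 * R := by
    have := norm_sub_le_norm_sub_add_norm_sub x xs xm
    rw [norm_sub_rev xs xm] at this
    linarith [hxm.2]
  have hFx_le : ‖F x - F xs‖ ≤ L * R := (hLip x hx xs hxsS).trans (by gcongr)
  have hFdiff_le : ‖F x - F xm‖ ≤ L * (2 * R) := (hLip x hx xm hxm).trans (by gcongr)
  have hκm : 0 < 1 - κm := by linarith
  have hκ : 0 < 1 - κ := by linarith
  have hdamp_le : (1 + 2 * μ * γm / (1 - κm))⁻¹ ≤ 1 :=
    inv_le_one_of_one_le₀ (le_add_of_nonneg_right (by positivity))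
  have hratio_le : (1 - κ) / (1 - κm) ≤ 3 / 2 := by
    rw [div_le_iff₀ hκm]; linarith
  have hβ0 : 0 ≤ β := by rw [hβ]; positivity
  have hα0 : 0 ≤ α := by rw [hα]; positivity
  have hγβ_le : γ * β ≤ 3 / 2 * γm := by
    have : γ * β = γm * ((1 - κ) / (1 - κm) * (1 + 2 * μ * γm / (1 - κm))⁻¹) := by
      rw [hβ]; field_simp
    have hprod : (1 - κ) / (1 - κm) * (1 + 2 * μ * γm / (1 - κm))⁻¹ ≤ 3 / 2 * 1 := by
      gcongr
    rw [this]
    nlinarith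
  have hα_le : α ≤ 1 / 2 := by
    rw [hα, div_le_iff₀ hγm0]
    nlinarith
  have hnorm : ‖xp - xs‖ ≤
      ‖(x - xs) + α • (x - xm) - (γ • (F x - F xs) + (γ * β) • (F x - F xm))‖ := by
    apply norm_le_norm_of_inner_sub_nonneg
    have hres : (x - xs) + α • (x - xm) - (γ • (F x - F xs) + (γ * β) • (F x - F xm))
        - (xp - xs) = γ • (u - -F xs) := by
      have hγu : γ • u = x + α • (x - xm) - γ • (F x + β • (F x - F xm)) - xp := by
        rw [hstep]; abel
      rw [smul_sub γ u, hγu]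
      module
    rw [hres, real_inner_smul_left]
    exact mul_nonneg hγ0.le (hmono xp xs u (-F xs) hu hxs)
  calc ‖xp - xs‖
      ≤ ‖x - xs‖ + ‖α • (x - xm)‖ + (‖γ • (F x - F xs)‖ + ‖(γ * β) • (F x - F xm)‖) :=
        hnorm.trans <| (norm_sub_le _ _).trans <|
          add_le_add (norm_add_le _ _) (norm_add_le _ _)
    _ = ‖x - xs‖ + α * ‖x - xm‖ + (γ * ‖F x - F xs‖ + (γ * β) * ‖F x - F xm‖) := by
        rw [norm_smul_of_nonneg hα0, norm_smul_of_nonneg hγ0.le,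
          norm_smul_of_nonneg (mul_nonneg hγ0.le hβ0)]
    _ ≤ R + 1 / 2 * (2 * R) + (γ₀ * (L * R) + (3 / 2 * γ₀) * (L * (2 * R))) := by
        have hγβ_le' : γ * β ≤ 3 / 2 * γ₀ := hγβ_le.trans (by gcongr)
        exact add_le_add (add_le_add hx_le (by gcongr))
          (add_le_add (by gcongr) (by gcongr ?_ * ?_))
    _ = (2 + 4 * γ₀ * L) * r / Real.sqrt (1 - 2 * ν ^ 2) := by
        rw [hR]; ring
end

section
/- Suppose F+B is monotone and x* ∈ ℝⁿ satisfies −F x* ∈ B x*. Fix ρ₀ ≥ 1, τ₀ ∈ (0,1], ζ > 1 and σ ∈ (0, 1/ζ), and set ρ_k = ρ₀ζ^k, τ_k = τ₀σ^k, and Λ = ρ₀τ₀/(1 − σζ). Let (z^k)_{k≥0} and (z*^k)_{k≥0} be sequences in ℝⁿ such that for every k ≥ 0: −ρ_k⁻¹(z*^k − z^k) ∈ (F+B)(z*^k) and ‖z^{k+1} − z*^k‖ ≤ ρ_kτ_k. Let ε > 0, r̄₀ = ‖z⁰ − x*‖, and K = ⌈max{ log(2(r̄₀+Λ)/(ερ₀))/log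 ζ , log(2τ₀/ε)/log(1/σ) }⌉₊, where ⌈a⌉₊ = max{⌈a⌉, 0}. Then ρ_K⁻¹‖z^{K+1} − z^K‖ ≤ ε/2 and τ_K ≤ ε/2. Consequently, if v ∈ ℝⁿ satisfies ‖v‖ ≤ τ_K and v − ρ_K⁻¹(z^{K+1} − z^K) ∈ (F+B)(z^{K+1}), then the vector w := v − ρ_K⁻¹(z^{K+1} − z^K) belongs to (F+B)(z^{K+1}) and satisfies ‖w‖ ≤ ε; i.e., z^{K+1} is an ε-residual solution of the monotone inclusion 0 ∈ (F+B)(x). -/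
open scoped RealInnerProductSpace

/-- If a point `p` satisfies `⟪-c • (p - a), p - s⟫ ≥ 0` with `c > 0`, then `p` is no farther from
`s` than `a` is, and the step `p - a` is no longer than `a - s`. -/
theorem norm_sub_le_of_inner_neg_smul_nonneg {E : Type*} [NormedAddCommGroup E]
    [InnerProductSpace ℝ E] {p a s : E} {c : ℝ} (hc : 0 < c)
    (h : 0 ≤ ⟪(-c) • (p - a), p - s⟫) :
    ‖p - s‖ ≤ ‖a - s‖ ∧ ‖p - a‖ ≤ ‖a - s‖ := by
  rw [real_inner_smul_left] at h
  have hinner : ⟪p - a, p - s⟫ ≤ 0 := by nlinarith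
  have hsq : ‖a - s‖ ^ 2 = ‖p - s‖ ^ 2 - 2 * ⟪p - a, p - s⟫ + ‖p - a‖ ^ 2 := by
    rw [real_inner_comm, ← norm_sub_sq_real, sub_sub_sub_cancel_left]
  constructor <;> refine le_of_sq_le_sq ?_ (norm_nonneg _) <;>
    nlinarith [sq_nonneg ‖p - s‖, sq_nonneg ‖p - a‖]

theorem le_pow_of_log_div_log_le {a b : ℝ} {k : ℕ} (ha : 0 < a) (hb : 1 < b)
    (h : Real.log a / Real.log b ≤ k) : a ≤ b ^ k := by
  rw [div_le_iff₀ (Real.log_pos hb), ← Real.log_pow] at h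
  exact (Real.log_le_log_iff ha (by positivity)).1 h

/-- A sequence whose increments are bounded by the terms `c * q ^ k` of a geometric progression
stays below its initial value plus the partial sums of the progression. -/
theorem le_add_mul_one_sub_pow {r : ℕ → ℝ} {c q L : ℝ} (hL : L * (1 - q) = c)
    (h : ∀ k, r (k + 1) ≤ r k + c * q ^ k) (k : ℕ) : r k ≤ r 0 + L * (1 - q ^ k) := by
  induction k with
  | zero => simp
  | succ k ih =>
    have hstep := h k
    rw [← hL] at hstep
    calc r (k + 1) ≤ r 0 + L * (1 - q ^ k) + L * (1 - q) * q ^ k := by linarith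
      _ = r 0 + L * (1 - q ^ (k + 1)) := by ring

/-- Theorem 3 (termination): after K+1 outer iterations of the proximal-point
primal-dual extrapolation method, the termination criterion is met and an
ε-residual solution of the monotone inclusion 0 ∈ (F+B)(x) is produced. -/
theorem stmt_17 (n : ℕ) (hn : 1 ≤ n)
    (B : EuclideanSpace ℝ (Fin n) → Set (EuclideanSpace ℝ (Fin n)))
    (F : EuclideanSpace ℝ (Fin n) → EuclideanSpace ℝ (Fin n))
    (hmono : ∀ x y u v, u ∈ B x → v ∈ B y →
      (0 : ℝ) ≤ ⟪(F x + u) - (F y + v), x - y⟫)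
    (xs : EuclideanSpace ℝ (Fin n)) (hxs : -F xs ∈ B xs)
    (ρ₀ τ₀ ζ σ Λ ε : ℝ)
    (hρ₀ : 1 ≤ ρ₀) (hτ₀0 : 0 < τ₀) (hτ₀1 : τ₀ ≤ 1) (hζ : 1 < ζ)
    (hσ0 : 0 < σ) (hσζ : σ < 1 / ζ)
    (hΛ : Λ = ρ₀ * τ₀ / (1 - σ * ζ)) (hε : 0 < ε)
    (z zs : ℕ → EuclideanSpace ℝ (Fin n))
    (hres : ∀ k : ℕ, (-(ρ₀ * ζ ^ k)⁻¹) • (zs k - z k) - F (zs k) ∈ B (zs k))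
    (happ : ∀ k : ℕ, ‖z (k + 1) - zs k‖ ≤ (ρ₀ * ζ ^ k) * (τ₀ * σ ^ k))
    (K : ℕ)
    (hK : K = ⌈max (Real.log (2 * (‖z 0 - xs‖ + Λ) / (ε * ρ₀)) / Real.log ζ)
      (Real.log (2 * τ₀ / ε) / Real.log (1 / σ))⌉₊) :
    (ρ₀ * ζ ^ K)⁻¹ * ‖z (K + 1) - z K‖ ≤ ε / 2 ∧
    τ₀ * σ ^ K ≤ ε / 2 ∧
    ∀ v : EuclideanSpace ℝ (Fin n), ‖v‖ ≤ τ₀ * σ ^ K →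
      (v - (ρ₀ * ζ ^ K)⁻¹ • (z (K + 1) - z K)) - F (z (K + 1)) ∈ B (z (K + 1)) →
      (v - (ρ₀ * ζ ^ K)⁻¹ • (z (K + 1) - z K)) - F (z (K + 1)) ∈ B (z (K + 1)) ∧
        ‖v - (ρ₀ * ζ ^ K)⁻¹ • (z (K + 1) - z K)‖ ≤ ε := by
  have hζ0 : 0 < ζ := by linarith
  have hρ₀0 : 0 < ρ₀ := by linarith
  have hq : σ * ζ < 1 := (lt_div_iff₀ hζ0).1 hσζ
  have hσ1 : 1 < 1 / σ := by
    rw [lt_div_iff₀ hσ0]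
    nlinarith
  have hΛq : Λ * (1 - σ * ζ) = ρ₀ * τ₀ := by
    rw [hΛ, div_mul_cancel₀ _ (by linarith)]
  have hΛ0 : 0 < Λ := by
    rw [hΛ]
    exact div_pos (by positivity) (by linarith)
  have hprod : ∀ k : ℕ, ρ₀ * ζ ^ k * (τ₀ * σ ^ k) = ρ₀ * τ₀ * (σ * ζ) ^ k := fun k => by ring
  have hprox : ∀ k, ‖zs k - xs‖ ≤ ‖z k - xs‖ ∧ ‖zs k - z k‖ ≤ ‖z k - xs‖ := fun k => by
    refine norm_sub_le_of_inner_neg_smul_nonneg (c := (ρ₀ * ζ ^ k)⁻¹) (by positivity) ?_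
    simpa using hmono _ _ _ _ (hres k) hxs
  have hdist : ∀ k, ‖z k - xs‖ ≤ ‖z 0 - xs‖ + Λ * (1 - (σ * ζ) ^ k) :=
    le_add_mul_one_sub_pow (r := fun k => ‖z k - xs‖) hΛq fun k => by
      have happ_k := happ k
      rw [hprod] at happ_k
      linarith [norm_sub_le_norm_sub_add_norm_sub (z (k + 1)) (zs k) xs, (hprox k).1]
  have hstep : ‖z (K + 1) - z K‖ ≤ ‖z 0 - xs‖ + Λ := by
    have happ_K := happ K
    rw [hprod, ← hΛq] at happ_K
    have hpos : 0 ≤ Λ * (σ * ζ) ^ (K + 1) := by positivity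
    rw [pow_succ] at hpos
    linarith [norm_sub_le_norm_sub_add_norm_sub (z (K + 1)) (zs K) (z K), (hprox K).2, hdist K]
  have hceil := hK ▸ Nat.le_ceil (max (Real.log (2 * (‖z 0 - xs‖ + Λ) / (ε * ρ₀)) / Real.log ζ)
      (Real.log (2 * τ₀ / ε) / Real.log (1 / σ)))
  have hζK := le_pow_of_log_div_log_le (by positivity) hζ ((le_max_left _ _).trans hceil)
  have hσK := le_pow_of_log_div_log_le (by positivity) hσ1 ((le_max_right _ _).trans hceil)
  have hres_le : (ρ₀ * ζ ^ K)⁻¹ * ‖z (K + 1) - z K‖ ≤ ε / 2 := by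
    rw [inv_mul_le_iff₀ (by positivity)]
    rw [div_le_iff₀ (by positivity)] at hζK
    linarith
  have hτ_le : τ₀ * σ ^ K ≤ ε / 2 := by
    rw [one_div, inv_pow, le_inv_comm₀ (by positivity) (by positivity), inv_div,
      le_div_iff₀ (by positivity)] at hσK
    linarith
  refine ⟨hres_le, hτ_le, fun v hv hmem => ⟨hmem, (norm_sub_le _ _).trans ?_⟩⟩
  rw [norm_smul, Real.norm_of_nonneg (by positivity)]
  linarith
end
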